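/- For every integer n ≥ 1 one has the polynomial identity ρ(x) S_n(x) = A_{2,n}(x) P_n(x) + B_{2,n}(x) P_{n−1}(x), where A_{2,n} and B_{2,n} are polynomials of degree at most d and d−1, respectively. -/

import Mathlib

open Polynomial MeasureTheory Finset

noncomputable section

/-- The `k`-th derivative of a real polynomial. -/
def iterDeriv (k : ℕ) (f : Polynomial ℝ) : Polynomial ℝ := Polynomial.derivative^[k] f

/-- The Jacobi measure `dμ^{α,β}(x) = (1-x)^α (1+x)^β dx` on `[-1,1]`. -/
def jacobiMeasure (α β : ℝ) : Measure ℝ :=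
  (volume.restrict (Set.Icc (-1 : ℝ) 1)).withDensity
    fun x => ENNReal.ofReal ((1 - x) ^ α * (1 + x) ^ β)

/-- The Jacobi–Sobolev inner product
`⟨f,g⟩_S = ∫ f g dμ^{α,β} + ∑_{j=1}^N ∑_{k=0}^{d_j} λ_{j,k} f^{(k)}(c_j) g^{(k)}(c_j)`. -/
def sobolevIP (α β : ℝ) {N : ℕ} (c : Fin N → ℝ) (dd : Fin N → ℕ)
    (lam : Fin N → ℕ → ℝ) (f g : Polynomial ℝ) : ℝ :=
  (∫ x, f.eval x * g.eval x ∂(jacobiMeasure α β)) +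
    ∑ j : Fin N, ∑ k ∈ Finset.range (dd j + 1),
      lam j k * (iterDeriv k f).eval (c j) * (iterDeriv k g).eval (c j)

/-- The degree-`k` Taylor polynomial of `f` centred at `c`:
`Q_k(x,c;f) = ∑_{ν=0}^k f^{(ν)}(c)(x-c)^ν/ν!` (as a polynomial in `x`). -/
def taylorPoly (k : ℕ) (c : ℝ) (f : Polynomial ℝ) : Polynomial ℝ :=
  ∑ ν ∈ Finset.range (k + 1),
    Polynomial.C ((iterDeriv ν f).eval c / Nat.factorial ν) * (X - Polynomial.C c) ^ ν

/-- `ρ(x) = ∏_{j=1}^N (x-c_j)^{d_j+1}`. -/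
def rhoPoly {N : ℕ} (c : Fin N → ℝ) (dd : Fin N → ℕ) : Polynomial ℝ :=
  ∏ j : Fin N, (X - Polynomial.C (c j)) ^ (dd j + 1)

/-- `ρ_{j,k}(x) = ρ(x)/(x-c_j)^{k+1} = (x-c_j)^{d_j-k} ∏_{i≠j} (x-c_i)^{d_i+1}`. -/
def rhoJK {N : ℕ} (c : Fin N → ℝ) (dd : Fin N → ℕ) (j : Fin N) (k : ℕ) : Polynomial ℝ :=
  (X - Polynomial.C (c j)) ^ (dd j - k) *
    ∏ i ∈ Finset.univ.erase j, (X - Polynomial.C (c i)) ^ (dd i + 1)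

/-- `â_n(x) = -n((2n+α+β)x+β-α)/(2n+α+β)`. -/
def ahat (α β : ℝ) (n : ℕ) : Polynomial ℝ :=
  Polynomial.C (-(n : ℝ) / (2 * (n : ℝ) + α + β)) *
    (Polynomial.C (2 * (n : ℝ) + α + β) * X + Polynomial.C (β - α))

/-- `b̂_n = 4n(n+α)(n+β)(n+α+β)/((2n+α+β)²(2n+α+β-1))`. -/
def bhat (α β : ℝ) (n : ℕ) : ℝ :=
  4 * (n : ℝ) * ((n : ℝ) + α) * ((n : ℝ) + β) * ((n : ℝ) + α + β) /
    ((2 * (n : ℝ) + α + β) ^ 2 * (2 * (n : ℝ) + α + β - 1))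

/-- `ĉ_n(x) = (n+α+β)((2n+α+β)x+α-β)/(2n+α+β)`. -/
def chat (α β : ℝ) (n : ℕ) : Polynomial ℝ :=
  Polynomial.C (((n : ℝ) + α + β) / (2 * (n : ℝ) + α + β)) *
    (Polynomial.C (2 * (n : ℝ) + α + β) * X + Polynomial.C (α - β))

/-- `d̂_n = -(2n+α+β-1)`. -/
def dhat (α β : ℝ) (n : ℕ) : ℝ := -(2 * (n : ℝ) + α + β - 1)

/-- `γ_{1,n} = (β²-α²)/((2n+α+β)(2n+α+β+2))`. -/
def gamma1 (α β : ℝ) (n : ℕ) : ℝ :=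
  (β ^ 2 - α ^ 2) / ((2 * (n : ℝ) + α + β) * (2 * (n : ℝ) + α + β + 2))

/-- `γ_{2,n} = 4n(n+α)(n+β)(n+α+β)/((2n+α+β)²((2n+α+β)²-1))`. -/
def gamma2 (α β : ℝ) (n : ℕ) : ℝ :=
  4 * (n : ℝ) * ((n : ℝ) + α) * ((n : ℝ) + β) * ((n : ℝ) + α + β) /
    ((2 * (n : ℝ) + α + β) ^ 2 * ((2 * (n : ℝ) + α + β) ^ 2 - 1))

/-- The Jacobi weight is integrable on `[-1,1]`. -/
lemma intervalIntegrable_jacobiWeight {α β : ℝ} (hα : -1 < α) (hβ : -1 < β) :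
    IntervalIntegrable (fun x : ℝ => (1 - x) ^ α * (1 + x) ^ β) volume (-1) 1 := by
  have hleft : IntervalIntegrable (fun x : ℝ => (1 - x) ^ α * (1 + x) ^ β) volume (-1) 0 := by
    have h1 : IntervalIntegrable (fun x : ℝ => (1 + x) ^ β) volume (-1) 0 := by
      simpa using
        (intervalIntegral.intervalIntegrable_rpow' (a := 0) (b := 1) hβ).comp_add_left 1
    refine h1.continuousOn_mul fun x hx => ?_
    rw [Set.uIcc_of_le (by norm_num)] at hx
    exact (ContinuousAt.rpow_const (by fun_prop)
      (Or.inl (by linarith [hx.2]))).continuousWithinAt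
  have hright : IntervalIntegrable (fun x : ℝ => (1 - x) ^ α * (1 + x) ^ β) volume 0 1 := by
    have h1 : IntervalIntegrable (fun x : ℝ => (1 - x) ^ α) volume 0 1 := by
      simpa using
        ((intervalIntegral.intervalIntegrable_rpow' (a := 0) (b := 1) hα).comp_sub_left 1).symm
    refine h1.mul_continuousOn fun x hx => ?_
    rw [Set.uIcc_of_le (by norm_num)] at hx
    exact (ContinuousAt.rpow_const (by fun_prop)
      (Or.inl (by linarith [hx.1]))).continuousWithinAt
  exact hleft.trans hright

lemma isFiniteMeasure_jacobiMeasure {α β : ℝ} (hα : -1 < α) (hβ : -1 < β) :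
    IsFiniteMeasure (jacobiMeasure α β) := by
  refine isFiniteMeasure_withDensity_ofReal (Integrable.hasFiniteIntegral ?_)
  exact (intervalIntegrable_iff_integrableOn_Icc_of_le (by norm_num)).1
    (intervalIntegrable_jacobiWeight hα hβ)

lemma jacobiMeasure_absolutelyContinuous (α β : ℝ) :
    jacobiMeasure α β ≪ volume.restrict (Set.Icc (-1 : ℝ) 1) :=
  withDensity_absolutelyContinuous _ _

lemma jacobiMeasure_ne_zero (α β : ℝ) : jacobiMeasure α β ≠ 0 := by
  intro h0
  rw [jacobiMeasure, withDensity_eq_zero_iff (by fun_prop)] at h0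
  have h1 := ae_restrict_of_ae_restrict_of_subset
    (Set.Ioo_subset_Icc_self (a := (-1 : ℝ)) (b := 1)) h0
  have h2 : ∀ᵐ x ∂volume.restrict (Set.Ioo (-1 : ℝ) 1), False := by
    filter_upwards [h1, ae_restrict_mem measurableSet_Ioo] with x hx hm
    have : 0 < (1 - x) ^ α * (1 + x) ^ β :=
      mul_pos (Real.rpow_pos_of_pos (by linarith [hm.2]) _)
        (Real.rpow_pos_of_pos (by linarith [hm.1]) _)
    rw [Pi.zero_apply, ENNReal.ofReal_eq_zero] at hx
    linarith
  rw [Filter.eventually_false_iff_eq_bot, ae_eq_bot, Measure.restrict_eq_zero] at h2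
  norm_num at h2

lemma integrable_eval_jacobiMeasure {α β : ℝ} (hα : -1 < α) (hβ : -1 < β) (p : ℝ[X]) :
    Integrable (fun x => p.eval x) (jacobiMeasure α β) := by
  have := isFiniteMeasure_jacobiMeasure hα hβ
  obtain ⟨M, hM⟩ := (isCompact_Icc (a := (-1 : ℝ)) (b := 1)).exists_bound_of_continuousOn
    p.continuous.continuousOn
  refine Integrable.of_bound p.continuous.aestronglyMeasurable M ?_
  refine (jacobiMeasure_absolutelyContinuous α β).ae_le ?_
  filter_upwards [ae_restrict_mem measurableSet_Icc] with x hx using hM x hx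

/-- Integration of polynomials against the Jacobi measure, as a linear functional. -/
def jacobiFunctional {α β : ℝ} (hα : -1 < α) (hβ : -1 < β) : ℝ[X] →ₗ[ℝ] ℝ where
  toFun p := ∫ x, p.eval x ∂(jacobiMeasure α β)
  map_add' p q := by
    simpa using integral_add (integrable_eval_jacobiMeasure hα hβ p)
      (integrable_eval_jacobiMeasure hα hβ q)
  map_smul' r p := by simp [integral_const_mul]

lemma jacobiFunctional_apply {α β : ℝ} (hα : -1 < α) (hβ : -1 < β) (p : ℝ[X]) :
    jacobiFunctional hα hβ p = ∫ x, p.eval x ∂(jacobiMeasure α β) := rfl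

lemma eq_zero_of_jacobiFunctional_mul_self {α β : ℝ} (hα : -1 < α) (hβ : -1 < β) {p : ℝ[X]}
    (hp : jacobiFunctional hα hβ (p * p) = 0) : p = 0 := by
  by_contra hne
  rw [jacobiFunctional_apply, integral_eq_zero_iff_of_nonneg
    (fun x => by simpa using mul_self_nonneg _) (integrable_eval_jacobiMeasure hα hβ _)] at hp
  have hroots : ∀ᵐ x ∂(jacobiMeasure α β), x ∉ p.rootSet ℝ := by
    refine (jacobiMeasure_absolutelyContinuous α β).ae_le (ae_restrict_of_ae ?_)
    exact (p.rootSet_finite ℝ).countable.ae_notMem volume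
  have : ∀ᵐ x ∂(jacobiMeasure α β), False := by
    filter_upwards [hp, hroots] with x hx hr
    refine hr (mem_rootSet.2 ⟨hne, ?_⟩)
    simpa using hx
  rw [Filter.eventually_false_iff_eq_bot, ae_eq_bot] at this
  exact jacobiMeasure_ne_zero α β this

/-- A linear functional vanishing on the first `n` members of a monic polynomial sequence vanishes
on all polynomials of degree less than `n`. -/
lemma map_eq_zero_of_degree_lt {P : ℕ → ℝ[X]} (hPm : ∀ m, (P m).Monic)
    (hPd : ∀ m, (P m).natDegree = m) (φ : ℝ[X] →ₗ[ℝ] ℝ) {n : ℕ} (hφ : ∀ l < n, φ (P l) = 0)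
    {q : ℝ[X]} (hq : q.degree < n) : φ q = 0 := by
  induction n generalizing q with
  | zero =>
    have : q = 0 := by simpa [Nat.WithBot.lt_zero_iff] using hq
    simp [this]
  | succ n ih =>
    have hlt : (q - q.coeff n • P n).degree < n := by
      rw [degree_lt_iff_coeff_zero] at hq ⊢
      intro m hm
      rcases hm.eq_or_lt with rfl | hm
      · have : (P n).coeff n = 1 := by simpa [Monic, leadingCoeff, hPd] using hPm n
        simp [this]
      · have : (P n).coeff m = 0 := coeff_eq_zero_of_natDegree_lt (by rwa [hPd])
        simp [this, hq m hm]
    have := ih (fun l hl => hφ l (by lia)) hlt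
    simpa [hφ n (by lia)] using this

section Orthogonal

variable {L : ℝ[X] →ₗ[ℝ] ℝ} {P : ℕ → ℝ[X]}

lemma map_mul_eq_zero_of_degree_lt (hPm : ∀ m, (P m).Monic) (hPd : ∀ m, (P m).natDegree = m)
    (hPo : ∀ m l, m ≠ l → L (P m * P l) = 0) {n : ℕ} {q : ℝ[X]} (hq : q.degree < n) :
    L (P n * q) = 0 :=
  map_eq_zero_of_degree_lt hPm hPd (L ∘ₗ LinearMap.mulLeft ℝ (P n))
    (fun l hl => hPo n l hl.ne') hq

lemma eq_zero_of_forall_map_mul (hL : ∀ p, L (p * p) = 0 → p = 0) (hPm : ∀ m, (P m).Monic)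
    (hPd : ∀ m, (P m).natDegree = m) {n : ℕ} {q : ℝ[X]} (hq : q.degree < n)
    (hqP : ∀ l < n, L (q * P l) = 0) : q = 0 :=
  hL q (map_eq_zero_of_degree_lt hPm hPd (L ∘ₗ LinearMap.mulLeft ℝ q) hqP hq)

lemma map_mul_self_ne_zero (hL : ∀ p, L (p * p) = 0 → p = 0) (hPm : ∀ m, (P m).Monic) (m : ℕ) :
    L (P m * P m) ≠ 0 :=
  fun h => (hPm m).ne_zero (hL _ h)

lemma degree_sub_lt_of_monic {p q : ℝ[X]} {n : ℕ} (hp : p.Monic) (hq : q.Monic)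
    (hpn : p.natDegree = n) (hqn : q.natDegree = n) : (p - q).degree < n := by
  have hd : p.degree = n := by rw [degree_eq_natDegree hp.ne_zero, hpn]
  have hd' : q.degree = n := by rw [degree_eq_natDegree hq.ne_zero, hqn]
  rw [← hd]
  exact degree_sub_lt_left (hd.trans hd'.symm) hp.ne_zero (by rw [hp.leadingCoeff, hq.leadingCoeff])

/-- The value of the functional on `X * P m * P (m + 1)`. -/
lemma map_X_mul_mul_succ (hPm : ∀ m, (P m).Monic) (hPd : ∀ m, (P m).natDegree = m)
    (hPo : ∀ m l, m ≠ l → L (P m * P l) = 0) (m : ℕ) :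
    L (P (m + 1) * (X * P m)) = L (P (m + 1) * P (m + 1)) := by
  rw [← sub_eq_zero, ← map_sub, ← mul_sub]
  refine map_mul_eq_zero_of_degree_lt hPm hPd hPo (degree_sub_lt_of_monic
    (monic_X.mul (hPm m)) (hPm _) ?_ (hPd _))
  rw [monic_X.natDegree_mul (hPm m), hPd, natDegree_X, add_comm]

/-- The three-term recurrence relation. -/
lemma exists_recurrence (hL : ∀ p, L (p * p) = 0 → p = 0) (hPm : ∀ m, (P m).Monic)
    (hPd : ∀ m, (P m).natDegree = m) (hPo : ∀ m l, m ≠ l → L (P m * P l) = 0) (m : ℕ) :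
    ∃ b : ℝ, X * P (m + 1) = P (m + 2) + b • P (m + 1) +
      (L (P (m + 1) * P (m + 1)) / L (P m * P m)) • P m := by
  have hdeg : ∀ l, (P l).degree = l := fun l => by
    rw [degree_eq_natDegree (hPm l).ne_zero, hPd]
  have h0 := map_mul_self_ne_zero hL hPm
  set b := L (X * P (m + 1) * P (m + 1)) / L (P (m + 1) * P (m + 1)) with hb
  refine ⟨b, sub_eq_zero.1 ?_⟩
  refine eq_zero_of_forall_map_mul hL hPm hPd (n := m + 2) ?_ fun l hl => ?_
  · have h1 : (X * P (m + 1) - P (m + 2)).degree < ((m + 2 : ℕ) : WithBot ℕ) := by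
      refine degree_sub_lt_of_monic (monic_X.mul (hPm _)) (hPm _) ?_ (hPd _)
      rw [monic_X.natDegree_mul (hPm _), hPd, natDegree_X]
      ring
    have h2 : ∀ (a : ℝ) l, l < m + 2 → (a • P l).degree < ((m + 2 : ℕ) : WithBot ℕ) :=
      fun a l hl => (degree_smul_le a (P l)).trans_lt (by rw [hdeg]; exact_mod_cast hl)
    rw [add_assoc, ← sub_sub]
    exact (degree_sub_le _ _).trans_lt (max_lt h1 ((degree_add_le _ _).trans_lt
      (max_lt (h2 _ _ (by lia)) (h2 _ _ (by lia)))))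
  · simp only [sub_mul, add_mul, smul_mul_assoc, map_sub, map_add, map_smul, smul_eq_mul]
    rw [hPo (m + 2) l (by lia)]
    rcases lt_trichotomy l m with h | rfl | h
    · rw [hPo (m + 1) l (by lia), hPo m l (by lia)]
      have : L (P (m + 1) * (X * P l)) = 0 := by
        refine map_mul_eq_zero_of_degree_lt hPm hPd hPo ?_
        rw [degree_mul, degree_X, hdeg]
        exact_mod_cast (by lia : 1 + l < m + 1)
      rw [show X * P (m + 1) * P l = P (m + 1) * (X * P l) by ring, this]
      simp
    · rw [hPo (l + 1) l (by lia), show X * P (l + 1) * P l = P (l + 1) * (X * P l) by ring,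
        map_X_mul_mul_succ hPm hPd hPo, div_mul_cancel₀ _ (h0 l)]
      simp
    · obtain rfl : l = m + 1 := by lia
      rw [hPo m (m + 1) (by lia), hb, div_mul_cancel₀ _ (h0 _)]
      simp

/-- The Christoffel–Darboux formula. -/
lemma christoffel_darboux (hL : ∀ p, L (p * p) = 0 → p = 0) (hPm : ∀ m, (P m).Monic)
    (hPd : ∀ m, (P m).natDegree = m) (hPo : ∀ m l, m ≠ l → L (P m * P l) = 0) (x : ℝ) (n : ℕ) :
    (C x - X) * ∑ m ∈ range (n + 1), C ((P m).eval x / L (P m * P m)) * P m =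
      C (1 / L (P n * P n)) * (C ((P (n + 1)).eval x) * P n - C ((P n).eval x) * P (n + 1)) := by
  induction n with
  | zero =>
    have hP0 : P 0 = 1 := (hPm 0).natDegree_eq_zero.1 (hPd 0)
    have hP1 : P 1 = X + C ((P 1).coeff 0) := (hPm 1).eq_X_add_C (hPd 1)
    rw [hP1]
    simp [hP0]
    ring
  | succ n ih =>
    obtain ⟨b, hb⟩ := exists_recurrence hL hPm hPd hPo n
    have h0 := map_mul_self_ne_zero hL hPm
    have hbx := congrArg (eval x) hb
    simp only [eval_mul, eval_X, eval_add, eval_smul, smul_eq_mul] at hbx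
    rw [sum_range_succ, mul_add, ih]
    refine Polynomial.funext fun y => ?_
    have hby := congrArg (eval y) hb
    simp only [eval_mul, eval_X, eval_add, eval_smul, smul_eq_mul] at hby
    have hn := h0 n
    have hn1 := h0 (n + 1)
    simp only [eval_mul, eval_add, eval_sub, eval_C, eval_X]
    set u := L (P n * P n)
    set v := L (P (n + 1) * P (n + 1))
    have hx2 : eval x (P (n + 2)) =
      x * eval x (P (n + 1)) - b * eval x (P (n + 1)) - v / u * eval x (P n) := by linarith
    have hy2 : eval y (P (n + 2)) =
      y * eval y (P (n + 1)) - b * eval y (P (n + 1)) - v / u * eval y (P n) := by linarith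
    rw [show n + 1 + 1 = n + 2 from rfl, hx2, hy2]
    field_simp
    ring

/-- A polynomial of degree less than `n` whose functional against `P l` equals `ψ (P l)` for all
`l < n` agrees with the reproducing-kernel expansion of `ψ`. -/
lemma eq_sum_of_map_mul_eq (hL : ∀ p, L (p * p) = 0 → p = 0) (hPm : ∀ m, (P m).Monic)
    (hPd : ∀ m, (P m).natDegree = m) (hPo : ∀ m l, m ≠ l → L (P m * P l) = 0)
    (ψ : ℝ[X] →ₗ[ℝ] ℝ) {n : ℕ} {q : ℝ[X]} (hq : q.degree < n)
    (hqP : ∀ l < n, L (q * P l) = ψ (P l)) :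
    q = ∑ m ∈ range n, (ψ (P m) / L (P m * P m)) • P m := by
  refine sub_eq_zero.1 (eq_zero_of_forall_map_mul hL hPm hPd (n := n) ?_ fun l hl => ?_)
  · refine (degree_sub_le _ _).trans_lt (max_lt hq ?_)
    refine (degree_sum_le _ _).trans_lt ((Finset.sup_lt_iff (WithBot.bot_lt_coe n)).2 fun m hm => ?_)
    refine (degree_smul_le _ _).trans_lt ?_
    rw [degree_eq_natDegree (hPm m).ne_zero, hPd]
    exact Nat.cast_lt.2 (mem_range.1 hm)
  · rw [sub_mul, map_sub, hqP l hl, sum_mul, map_sum, sum_eq_single_of_mem l (mem_range.2 hl)]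
    · rw [smul_mul_assoc, map_smul, smul_eq_mul, div_mul_cancel₀ _ (map_mul_self_ne_zero hL hPm l),
        sub_self]
    · intro m _ hml
      rw [smul_mul_assoc, map_smul, hPo m l hml, smul_zero]

end Orthogonal

lemma iterDeriv_succ (k : ℕ) (f : ℝ[X]) : iterDeriv (k + 1) f = derivative (iterDeriv k f) :=
  Function.iterate_succ_apply' _ _ _

/-- The `k`-th derivative at `c`, as a linear functional. -/
def iterDerivEval (k : ℕ) (c : ℝ) : ℝ[X] →ₗ[ℝ] ℝ :=
  leval c ∘ₗ derivative ^ k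

lemma iterDerivEval_apply (k : ℕ) (c : ℝ) (f : ℝ[X]) :
    iterDerivEval k c f = (iterDeriv k f).eval c := by
  simp [iterDerivEval, iterDeriv, Module.End.pow_apply]

lemma iterDeriv_succ_sub_X_mul (x : ℝ) (G : ℝ[X]) (k : ℕ) :
    iterDeriv (k + 1) ((C x - X) * G) =
      (C x - X) * iterDeriv (k + 1) G - ((k + 1 : ℕ) : ℝ[X]) * iterDeriv k G := by
  induction k with
  | zero => simp [iterDeriv]; ring
  | succ k ih =>
    rw [iterDeriv_succ, ih, iterDeriv_succ (k + 1) G, iterDeriv_succ k G]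
    simp
    ring

/-- Differentiating `(x - y) G(y)` repeatedly in `y` produces Taylor polynomials. -/
lemma pow_mul_iterDeriv_eval (x y : ℝ) (G : ℝ[X]) (k : ℕ) :
    (x - y) ^ (k + 1) * (iterDeriv k G).eval y =
      k.factorial * (taylorPoly k y ((C x - X) * G)).eval x := by
  induction k with
  | zero => simp [iterDeriv, taylorPoly]
  | succ k ih =>
    have hQ : taylorPoly (k + 1) y ((C x - X) * G) = taylorPoly k y ((C x - X) * G) +
        C ((iterDeriv (k + 1) ((C x - X) * G)).eval y / (k + 1).factorial) *
          (X - C y) ^ (k + 1) := sum_range_succ _ _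
    have hf : (k.factorial : ℝ) ≠ 0 := by positivity
    have hk : (k : ℝ) + 1 ≠ 0 := by positivity
    rw [hQ, eval_add, mul_add, Nat.factorial_succ, Nat.cast_mul, mul_assoc, ← ih,
      iterDeriv_succ_sub_X_mul]
    simp
    field_simp
    ring

lemma taylorPoly_sub (k : ℕ) (y : ℝ) (f g : ℝ[X]) :
    taylorPoly k y (f - g) = taylorPoly k y f - taylorPoly k y g := by
  simp only [taylorPoly, ← iterDerivEval_apply, map_sub, sub_div, sub_mul, sum_sub_distrib]

lemma taylorPoly_C_mul (k : ℕ) (y a : ℝ) (f : ℝ[X]) :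
    taylorPoly k y (C a * f) = C a * taylorPoly k y f := by
  simp only [taylorPoly, ← iterDerivEval_apply, ← smul_eq_C_mul, map_smul, smul_eq_mul,
    mul_div_assoc, smul_sum]
  simp only [smul_eq_C_mul, C_mul, mul_assoc]

lemma natDegree_taylorPoly_le (k : ℕ) (y : ℝ) (f : ℝ[X]) : (taylorPoly k y f).natDegree ≤ k := by
  refine natDegree_sum_le_of_forall_le _ _ fun ν hν => (natDegree_C_mul_le _ _).trans ?_
  rw [natDegree_pow, natDegree_X_sub_C, mul_one]
  exact Nat.lt_succ_iff.1 (mem_range.1 hν)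

section Rho

variable {N : ℕ} (c : Fin N → ℝ) (dd : Fin N → ℕ)

lemma natDegree_prod_X_sub_C_pow (s : Finset (Fin N)) :
    (∏ j ∈ s, (X - C (c j)) ^ (dd j + 1)).natDegree = ∑ j ∈ s, (dd j + 1) := by
  rw [natDegree_prod_of_monic _ _ fun j _ => (monic_X_sub_C _).pow _]
  simp

lemma natDegree_rhoPoly : (rhoPoly c dd).natDegree = ∑ j, (dd j + 1) :=
  natDegree_prod_X_sub_C_pow c dd univ

lemma rhoPoly_eq_pow_mul_rhoJK {j : Fin N} {k : ℕ} (hk : k ≤ dd j) :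
    rhoPoly c dd = (X - C (c j)) ^ (k + 1) * rhoJK c dd j k := by
  rw [rhoPoly, rhoJK, ← mul_prod_erase univ _ (mem_univ j), ← mul_assoc, ← pow_add,
    show k + 1 + (dd j - k) = dd j + 1 by lia]

lemma natDegree_rhoJK_le {j : Fin N} {k : ℕ} (hk : k ≤ dd j) :
    (rhoJK c dd j k).natDegree + (k + 1) ≤ ∑ j, (dd j + 1) := by
  have h1 : (rhoJK c dd j k).natDegree ≤ (dd j - k) + ∑ i ∈ univ.erase j, (dd i + 1) := by
    refine natDegree_mul_le.trans (add_le_add ?_ (natDegree_prod_X_sub_C_pow c dd _).le)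
    rw [natDegree_pow, natDegree_X_sub_C, mul_one]
  rw [← add_sum_erase univ _ (mem_univ j)]
  lia

lemma natDegree_sum_taylorPoly_mul_rhoJK_le (a : Fin N → ℕ → ℝ) (f : ℝ[X]) :
    (∑ j : Fin N, ∑ k ∈ range (dd j + 1),
      C (a j k) * (taylorPoly k (c j) f * rhoJK c dd j k)).natDegree ≤
      (∑ j, (dd j + 1)) - 1 := by
  refine natDegree_sum_le_of_forall_le _ _ fun j _ =>
    natDegree_sum_le_of_forall_le _ _ fun k hk => (natDegree_C_mul_le _ _).trans ?_
  have h1 := natDegree_taylorPoly_le k (c j) f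
  have h2 := natDegree_rhoJK_le c dd (Nat.lt_succ_iff.1 (mem_range.1 hk))
  exact natDegree_mul_le.trans (by lia)

end Rho

theorem stmt8 (α β : ℝ) (hα : -1 < α) (hβ : -1 < β)
    (N : ℕ) (hN : 1 ≤ N)
    (c : Fin N → ℝ) (hc : Function.Injective c) (hcout : ∀ j, c j ∉ Set.Ioo (-1 : ℝ) 1)
    (dd : Fin N → ℕ) (hdd : Monotone dd)
    (lam : Fin N → ℕ → ℝ) (hlam : ∀ j k, 0 ≤ lam j k) (hlamd : ∀ j, 0 < lam j (dd j))
    (d : ℕ) (hd : d = ∑ j, (dd j + 1))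
    (P : ℕ → Polynomial ℝ) (hPm : ∀ m, (P m).Monic) (hPd : ∀ m, (P m).natDegree = m)
    (hPo : ∀ m l, m ≠ l → ∫ x, (P m).eval x * (P l).eval x ∂(jacobiMeasure α β) = 0)
    (h : ℕ → ℝ) (hh : ∀ m, h m = ∫ x, ((P m).eval x) ^ 2 ∂(jacobiMeasure α β))
    (S : ℕ → Polynomial ℝ) (hSm : ∀ m, (S m).Monic) (hSd : ∀ m, (S m).natDegree = m)
    (hSo : ∀ m l, l < m → sobolevIP α β c dd lam (X ^ l) (S m) = 0)
    (A2 B2 : ℕ → Polynomial ℝ)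
    (hA2 : ∀ m, 1 ≤ m → A2 m = rhoPoly c dd -
      ∑ j : Fin N, ∑ k ∈ Finset.range (dd j + 1),
        Polynomial.C ((Nat.factorial k : ℝ) * lam j k * (iterDeriv k (S m)).eval (c j) / h (m - 1)) *
          (taylorPoly k (c j) (P (m - 1)) * rhoJK c dd j k))
    (hB2 : ∀ m, 1 ≤ m → B2 m =
      ∑ j : Fin N, ∑ k ∈ Finset.range (dd j + 1),
        Polynomial.C ((Nat.factorial k : ℝ) * lam j k * (iterDeriv k (S m)).eval (c j) / h (m - 1)) *
          (taylorPoly k (c j) (P m) * rhoJK c dd j k))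
    (n : ℕ) (hn : 1 ≤ n) :
    rhoPoly c dd * S n = A2 n * P n + B2 n * P (n - 1) ∧
      (A2 n).natDegree ≤ d ∧ (B2 n).natDegree ≤ d - 1 := by
  subst hd
  obtain ⟨m, rfl⟩ : ∃ m, n = m + 1 := ⟨n - 1, by lia⟩
  have hA := hA2 (m + 1) hn
  have hB := hB2 (m + 1) hn
  rw [Nat.add_sub_cancel] at hA hB ⊢
  refine ⟨?_, ?_, ?_⟩
  · set L := jacobiFunctional hα hβ with hLdef
    have hL : ∀ p, L (p * p) = 0 → p = 0 := fun p => eq_zero_of_jacobiFunctional_mul_self hα hβ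
    have hLmul : ∀ p q : ℝ[X], L (p * q) = ∫ x, p.eval x * q.eval x ∂(jacobiMeasure α β) :=
      fun p q => by simp [hLdef, jacobiFunctional_apply]
    have hPo' : ∀ m l, m ≠ l → L (P m * P l) = 0 := fun m l hml => by rw [hLmul, hPo m l hml]
    have hh' : ∀ m, h m = L (P m * P m) := fun m => by simp only [hLmul, hh, sq]
    set ψ : ℝ[X] →ₗ[ℝ] ℝ := ∑ j : Fin N, ∑ k ∈ range (dd j + 1),
      (lam j k * (iterDeriv k (S (m + 1))).eval (c j)) • iterDerivEval k (c j) with hψ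
    have hψ_apply : ∀ f, ψ f = ∑ j : Fin N, ∑ k ∈ range (dd j + 1),
        lam j k * (iterDeriv k f).eval (c j) * (iterDeriv k (S (m + 1))).eval (c j) := fun f => by
      simp only [hψ, LinearMap.sum_apply, LinearMap.smul_apply, iterDerivEval_apply, smul_eq_mul]
      exact sum_congr rfl fun j _ => sum_congr rfl fun k _ => by ring
    have hSψ : ∀ f : ℝ[X], f.degree < ((m + 1 : ℕ) : WithBot ℕ) →
        L (S (m + 1) * f) + ψ f = 0 := fun f hf =>
      map_eq_zero_of_degree_lt (P := fun l => X ^ l) (fun l => monic_X_pow l)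
        (fun l => natDegree_X_pow l) (L ∘ₗ LinearMap.mulLeft ℝ (S (m + 1)) + ψ)
        (fun l hl => by
          have := hSo (m + 1) l hl
          rw [sobolevIP, ← hψ_apply, ← hLmul] at this
          simpa [mul_comm] using this) hf
    have hS : P (m + 1) - S (m + 1) =
        ∑ l ∈ range (m + 1), (ψ (P l) / L (P l * P l)) • P l := by
      refine eq_sum_of_map_mul_eq hL hPm hPd hPo' ψ
        (degree_sub_lt_of_monic (hPm _) (hSm _) (hPd _) (hSd _)) fun l hl => ?_
      have hl' := hSψ (P l) (by
        rw [degree_eq_natDegree (hPm l).ne_zero, hPd]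
        exact_mod_cast hl)
      rw [sub_mul, map_sub, hPo' _ _ hl.ne']
      linarith
    refine Polynomial.funext fun x => ?_
    set G : ℝ[X] := ∑ l ∈ range (m + 1), C ((P l).eval x / L (P l * P l)) * P l with hG
    have hSx : (S (m + 1)).eval x = (P (m + 1)).eval x - ψ G := by
      have h1 := congrArg (eval x) hS
      have h2 : ψ G = eval x (∑ l ∈ range (m + 1), (ψ (P l) / L (P l * P l)) • P l) := by
        rw [hG, map_sum, eval_finsetSum]
        refine sum_congr rfl fun l _ => ?_
        rw [← smul_eq_C_mul, map_smul, eval_smul, smul_eq_mul, smul_eq_mul]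
        ring
      rw [h2, ← h1, eval_sub]
      ring
    have hterm : ∀ j, ∀ k ∈ range (dd j + 1), (rhoPoly c dd).eval x *
        (lam j k * (iterDeriv k G).eval (c j) * (iterDeriv k (S (m + 1))).eval (c j)) =
        (k.factorial * lam j k * (iterDeriv k (S (m + 1))).eval (c j) / h m) *
          ((taylorPoly k (c j) (P m)).eval x * (rhoJK c dd j k).eval x) * (P (m + 1)).eval x -
        (k.factorial * lam j k * (iterDeriv k (S (m + 1))).eval (c j) / h m) *
          ((taylorPoly k (c j) (P (m + 1))).eval x * (rhoJK c dd j k).eval x) * (P m).eval x := by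
      intro j k hk
      have h1 := pow_mul_iterDeriv_eval x (c j) G k
      rw [hG, christoffel_darboux hL hPm hPd hPo' x m, ← hG, ← hh', taylorPoly_C_mul,
        taylorPoly_sub, taylorPoly_C_mul, taylorPoly_C_mul] at h1
      simp only [eval_mul, eval_sub, eval_C] at h1
      rw [rhoPoly_eq_pow_mul_rhoJK c dd (Nat.lt_succ_iff.1 (mem_range.1 hk))]
      simp only [eval_mul, eval_pow, eval_sub, eval_X, eval_C]
      linear_combination (rhoJK c dd j k).eval x * lam j k *
        (iterDeriv k (S (m + 1))).eval (c j) * h1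
    rw [hA, hB]
    simp only [eval_mul, eval_add, eval_sub, eval_finsetSum, eval_C]
    have hsum := sum_congr rfl fun j (_ : j ∈ univ) => sum_congr rfl (hterm j)
    simp only [← mul_sum, ← hψ_apply, sum_sub_distrib, ← sum_mul] at hsum
    rw [hSx, mul_sub, hsum]
    ring
  · rw [hA]
    refine (natDegree_sub_le _ _).trans (max_le (natDegree_rhoPoly c dd).le ?_)
    exact (natDegree_sum_taylorPoly_mul_rhoJK_le c dd _ _).trans (Nat.sub_le _ _)
  · rw [hB]
    exact natDegree_sum_taylorPoly_mul_rhoJK_le c dd _ _
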